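/- arXiv:0807.0620 — 4 statements merged into one kernel-verified Lean document; each statement's English description precedes it below -/
import Mathlib

section
/- Let g ∈ K_p and k ∈ I_p, and write g = (g₁, g₂; g₃, g₄) and g·k = (g₁', g₂'; g₃', g₄') in 2×2 blocks. Then the rank over 𝔽_p of the reduction modulo p of g₁ equals that of g₁', and the rank over 𝔽_p of the reduction modulo p of g₃ equals that of g₃'. In other words, as a matrix varies within a fixed left coset of I_p in K_p, the pair of mod-p ranks of its upper-left and lower-left 2×2 blocks is constant. -/
open Matrix

noncomputable section

variable (p : ℕ) [Fact p.Prime]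

def JmatZ : Matrix (Fin 4) (Fin 4) ℤ_[p] := !![0,0,1,0; 0,0,0,1; -1,0,0,0; 0,-1,0,0]

def KpZ : Set (Matrix (Fin 4) (Fin 4) ℤ_[p]) :=
  {g | IsUnit g.det ∧ ∃ μ : ℤ_[p]ˣ, gᵀ * JmatZ p * g = (μ : ℤ_[p]) • JmatZ p}

def IpZ : Set (Matrix (Fin 4) (Fin 4) ℤ_[p]) :=
  {g | g ∈ KpZ p ∧ PadicInt.toZMod (g 0 1) = 0 ∧ PadicInt.toZMod (g 2 0) = 0 ∧
    PadicInt.toZMod (g 2 1) = 0 ∧ PadicInt.toZMod (g 3 0) = 0 ∧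
    PadicInt.toZMod (g 3 1) = 0 ∧ PadicInt.toZMod (g 3 2) = 0}

def redUL (g : Matrix (Fin 4) (Fin 4) ℤ_[p]) : Matrix (Fin 2) (Fin 2) (ZMod p) :=
  (g.map (PadicInt.toZMod)).submatrix (![0,1] : Fin 2 → Fin 4) (![0,1] : Fin 2 → Fin 4)

def redLL (g : Matrix (Fin 4) (Fin 4) ℤ_[p]) : Matrix (Fin 2) (Fin 2) (ZMod p) :=
  (g.map (PadicInt.toZMod)).submatrix (![2,3] : Fin 2 → Fin 4) (![0,1] : Fin 2 → Fin 4)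

theorem isUnit_det_redUL_of_mem_IpZ {k : Matrix (Fin 4) (Fin 4) ℤ_[p]} (hk : k ∈ IpZ p) :
    IsUnit (redUL p k).det := by
  obtain ⟨⟨-, μ, hμ⟩, h01, h20, h21, h30, h31, h32⟩ := hk
  have hunit : IsUnit (PadicInt.toZMod (μ : ℤ_[p])) := μ.isUnit.map _
  have h02 : PadicInt.toZMod (k 0 0) * PadicInt.toZMod (k 2 2) = PadicInt.toZMod (μ : ℤ_[p]) := by
    simpa [Matrix.mul_apply, Fin.sum_univ_four, JmatZ, h20, h30, h32] using
      congrArg PadicInt.toZMod (congrFun (congrFun hμ 0) 2)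
  have h13 : PadicInt.toZMod (k 1 1) * PadicInt.toZMod (k 3 3) = PadicInt.toZMod (μ : ℤ_[p]) := by
    simpa [Matrix.mul_apply, Fin.sum_univ_four, JmatZ, h01, h21, h31] using
      congrArg PadicInt.toZMod (congrFun (congrFun hμ 1) 3)
  have hdet : (redUL p k).det = PadicInt.toZMod (k 0 0) * PadicInt.toZMod (k 1 1) := by
    rw [Matrix.det_fin_two]
    simp [redUL, -Matrix.submatrix_cons_row, h01]
  rw [hdet]
  exact (isUnit_of_mul_isUnit_left (h02 ▸ hunit)).mul (isUnit_of_mul_isUnit_left (h13 ▸ hunit))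

theorem submatrix_map_mul_of_mem_IpZ {m : Type*} (r : m → Fin 4)
    (g : Matrix (Fin 4) (Fin 4) ℤ_[p]) {k : Matrix (Fin 4) (Fin 4) ℤ_[p]} (hk : k ∈ IpZ p) :
    ((g * k).map PadicInt.toZMod).submatrix r ![0, 1] =
      (g.map PadicInt.toZMod).submatrix r ![0, 1] * redUL p k := by
  obtain ⟨-, -, h20, h21, h30, h31, -⟩ := hk
  ext i j
  fin_cases j <;>
    simp [redUL, -Matrix.submatrix_cons_row, Matrix.mul_apply, Fin.sum_univ_four, Fin.sum_univ_two,
      h20, h21, h30, h31]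

theorem rank_constant_on_cosets (g k : Matrix (Fin 4) (Fin 4) ℤ_[p])
    (hg : g ∈ KpZ p) (hk : k ∈ IpZ p) :
    (redUL p g).rank = (redUL p (g * k)).rank ∧
    (redLL p g).rank = (redLL p (g * k)).rank := by
  have hdet := isUnit_det_redUL_of_mem_IpZ p hk
  constructor
  · exact ((congrArg Matrix.rank (submatrix_map_mul_of_mem_IpZ p _ g hk)).trans
      (Matrix.rank_mul_eq_left_of_isUnit_det _ _ hdet)).symm
  · exact ((congrArg Matrix.rank (submatrix_map_mul_of_mem_IpZ p _ g hk)).trans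
      (Matrix.rank_mul_eq_left_of_isUnit_det _ _ hdet)).symm
end
end

section
/- For every l ∈ ℤ and every integer m > 0, the matrices A_{(0,0,0)}^y for y ∈ V \ {0} are pairwise (l,m)-equivalent. For m = 0, the matrices A_{(0,0,0)}^y for all y ∈ V are pairwise (l,0)-equivalent. -/
open Matrix

noncomputable section

variable (p : ℕ) [Fact p.Prime]

/-- The 4×4 symplectic similitude matrix `J`. -/
def Jmat : Matrix (Fin 4) (Fin 4) ℚ_[p] :=
  !![0,0,1,0; 0,0,0,1; -1,0,0,0; 0,-1,0,0]

/-- `GSp₄(ℚ_p)`. -/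
def GSp4 : Set (Matrix (Fin 4) (Fin 4) ℚ_[p]) :=
  {g | IsUnit g.det ∧ ∃ μ : ℚ_[p]ˣ, gᵀ * Jmat p * g = (μ : ℚ_[p]) • Jmat p}

/-- `K_p = GSp₄(ℤ_p)`, viewed inside `GSp₄(ℚ_p)`. -/
def Kp : Set (Matrix (Fin 4) (Fin 4) ℚ_[p]) :=
  {g | g ∈ GSp4 p ∧ (∀ i j, ‖g i j‖ ≤ 1) ∧ ‖g.det‖ = 1}

/-- The Iwahori subgroup `I_p`: elements of `K_p` whose reduction mod `p` has zero
entries at positions (1,2), (3,1), (3,2), (4,1), (4,2), (4,3) (0-indexed below). -/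
def Ip : Set (Matrix (Fin 4) (Fin 4) ℚ_[p]) :=
  {g | g ∈ Kp p ∧ ‖g 0 1‖ < 1 ∧ ‖g 2 0‖ < 1 ∧ ‖g 2 1‖ < 1 ∧
      ‖g 3 0‖ < 1 ∧ ‖g 3 1‖ < 1 ∧ ‖g 3 2‖ < 1}

/-- The matrix `U_x` for `x = (n,q,r)`. -/
def Umat (n q r : ℚ_[p]) : Matrix (Fin 4) (Fin 4) ℚ_[p] :=
  !![1,0,n,q; 0,1,q,r; 0,0,1,0; 0,0,0,1]

/-- The matrix `Z_y` for `y ∈ ℤ_p`. -/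
def Zmat (y : ℚ_[p]) : Matrix (Fin 4) (Fin 4) ℚ_[p] :=
  !![1,y,0,0; 0,1,0,0; 0,0,1,0; 0,0,-y,1]

/-- The matrix `Z_∞`. -/
def Zinf : Matrix (Fin 4) (Fin 4) ℚ_[p] :=
  !![0,1,0,0; 1,0,0,0; 0,0,0,1; 0,0,1,0]

/-- `Z_v` for `v ∈ V = Y ∪ {∞}`, where `Y = {0,…,p−1}` is modelled by `Fin p`
and `∞` by `none`. -/
def ZV : Option (Fin p) → Matrix (Fin 4) (Fin 4) ℚ_[p]
  | some y => Zmat p (y.val : ℚ_[p])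
  | none => Zinf p

/-- Class A matrices `A_x^y = U_x · J · Z_y`. -/
def Amat (x : Fin p × Fin p × Fin p) (v : Option (Fin p)) : Matrix (Fin 4) (Fin 4) ℚ_[p] :=
  Umat p (x.1.val : ℚ_[p]) (x.2.1.val : ℚ_[p]) (x.2.2.val : ℚ_[p]) * Jmat p * ZV p v

/-- Class B matrices `B_x^y = J · U_x · J · Z_y`. -/
def Bmat (x : Fin p × Fin p × Fin p) (v : Option (Fin p)) : Matrix (Fin 4) (Fin 4) ℚ_[p] :=
  Jmat p * Umat p (x.1.val : ℚ_[p]) (x.2.1.val : ℚ_[p]) (x.2.2.val : ℚ_[p]) * Jmat p * ZV p v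

/-- Assemble a 4×4 matrix from 2×2 blocks. -/
def blk (A B C D : Matrix (Fin 2) (Fin 2) ℚ_[p]) : Matrix (Fin 4) (Fin 4) ℚ_[p] :=
  Matrix.reindex finSumFinEquiv finSumFinEquiv (fromBlocks A B C D)

variable (a b c : ℚ_[p])

/-- The matrix `S = (a, b/2; b/2, c)`. -/
def Smat : Matrix (Fin 2) (Fin 2) ℚ_[p] := !![a, b/2; b/2, c]

/-- The matrix `ξ = (b/2, c; −a, −b/2)`. -/
def xiS : Matrix (Fin 2) (Fin 2) ℚ_[p] := !![b/2, c; -a, -b/2]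

/-- The torus `T(ℚ_p) = {g ∈ GL₂(ℚ_p) : gᵀSg = det(g)·S}`. -/
def Tgrp : Set (Matrix (Fin 2) (Fin 2) ℚ_[p]) :=
  {g | IsUnit g.det ∧ gᵀ * Smat p a b c * g = g.det • Smat p a b c}

/-- The embedding `g ↦ diag(g, det(g)·(g⁻¹)ᵀ)` of `GL₂` into `GSp₄`. -/
def emb (g : Matrix (Fin 2) (Fin 2) ℚ_[p]) : Matrix (Fin 4) (Fin 4) ℚ_[p] :=
  blk p g 0 0 (g.det • (g⁻¹)ᵀ)

/-- The unipotent group `U(ℚ_p)`. -/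
def Ugrp : Set (Matrix (Fin 4) (Fin 4) ℚ_[p]) :=
  {u | ∃ X : Matrix (Fin 2) (Fin 2) ℚ_[p], Xᵀ = X ∧ u = blk p 1 X 0 1}

/-- The Bessel group `R(ℚ_p) = T(ℚ_p)·U(ℚ_p)` inside `GSp₄(ℚ_p)`. -/
def Rgrp : Set (Matrix (Fin 4) (Fin 4) ℚ_[p]) :=
  {r | ∃ t ∈ Tgrp p a b c, ∃ u ∈ Ugrp p, r = emb p t * u}

/-- `h(l,m) = diag(p^{2m+l}, p^{m+l}, 1, p^m)`. -/
def hmat (l : ℤ) (m : ℕ) : Matrix (Fin 4) (Fin 4) ℚ_[p] :=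
  diagonal ![(p : ℚ_[p]) ^ (2 * (m : ℤ) + l), (p : ℚ_[p]) ^ ((m : ℤ) + l), 1, (p : ℚ_[p]) ^ (m : ℤ)]

/-- `(l,m)`-equivalence: `f ~ g` iff `r·h(l,m)·f·k = h(l,m)·g` for some
`r ∈ R(ℚ_p)`, `k ∈ I_p`. -/
def LMEquiv (l : ℤ) (m : ℕ) (f g : Matrix (Fin 4) (Fin 4) ℚ_[p]) : Prop :=
  ∃ r ∈ Rgrp p a b c, ∃ k ∈ Ip p, r * hmat p l m * f * k = hmat p l m * g

/-- The binary quadratic form governing the action of the torus, conjugated by `h(l,m)` with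
`P = p^m`, on lines. -/
def besselForm (P α β : ℚ_[p]) : ℚ_[p] := -(c * α ^ 2) + P * b * α * β - P ^ 2 * a * β ^ 2

/-- First coordinate of the second column of `Z_v`. -/
def dirV : Option (Fin p) → ℚ_[p]
  | some y => (y.val : ℚ_[p])
  | none => 1

/-- Second coordinate of the second column of `Z_v`. -/
def dirV' : Option (Fin p) → ℚ_[p]
  | some _ => 1
  | none => 0

theorem blk_eq (A B C D : Matrix (Fin 2) (Fin 2) ℚ_[p]) :
    blk p A B C D =
      !![A 0 0, A 0 1, B 0 0, B 0 1; A 1 0, A 1 1, B 1 0, B 1 1;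
        C 0 0, C 0 1, D 0 0, D 0 1; C 1 0, C 1 1, D 1 0, D 1 1] := by
  ext i j
  fin_cases i <;> fin_cases j <;> rfl

theorem emb_eq (x y z w : ℚ_[p]) (h : x * w - y * z ≠ 0) :
    emb p !![x, y; z, w] = !![x, y, 0, 0; z, w, 0, 0; 0, 0, w, -z; 0, 0, -y, x] := by
  have hdet : (!![x, y; z, w] : Matrix (Fin 2) (Fin 2) ℚ_[p]).det = x * w - y * z := by
    simp [Matrix.det_fin_two]
  have hcof : (!![x, y; z, w] : Matrix (Fin 2) (Fin 2) ℚ_[p]).det • (!![x, y; z, w]⁻¹)ᵀ =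
      !![w, -z; -y, x] := by
    rw [Matrix.inv_def, hdet, Matrix.adjugate_fin_two_of, Ring.inverse_eq_inv',
      Matrix.transpose_smul, smul_smul, mul_inv_cancel₀ h, one_smul]
    ext i j
    fin_cases i <;> fin_cases j <;> rfl
  rw [emb, hcof, blk_eq]
  simp

theorem torus_mem (X Y : ℚ_[p]) (h : X * (X + Y * b) + Y ^ 2 * (a * c) ≠ 0) :
    !![X + Y * b, Y * c; -(Y * a), X] ∈ Tgrp p a b c := by
  have hdet : (!![X + Y * b, Y * c; -(Y * a), X] : Matrix (Fin 2) (Fin 2) ℚ_[p]).det =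
      X * (X + Y * b) + Y ^ 2 * (a * c) := by
    rw [Matrix.det_fin_two_of]; ring
  refine ⟨by rw [hdet]; exact h.isUnit, ?_⟩
  rw [hdet]
  ext i j
  fin_cases i <;> fin_cases j <;>
    simp [Smat, Matrix.mul_apply, Fin.sum_univ_succ] <;> ring

theorem norm_one_of_sq {e : ℚ_[p]} (he : e ^ 2 = 1) : ‖e‖ = 1 := by
  have : ‖e‖ ^ 2 = 1 := by rw [← norm_pow, he, norm_one]
  exact (pow_eq_one_iff_of_nonneg (norm_nonneg _) two_ne_zero).1 this

/-- A block-diagonal matrix of the Iwahori subgroup with lower triangular upper block. -/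
theorem iwahori_mem (e x y : ℚ_[p]) (he : e ^ 2 = 1) (hx : ‖x‖ = 1) (hy : ‖y‖ ≤ 1) :
    !![x, 0, 0, 0; y, 1, 0, 0; 0, 0, e, -(e * y); 0, 0, 0, e * x] ∈ Ip p := by
  have hen : ‖e‖ = 1 := norm_one_of_sq p he
  have he0 : e ≠ 0 := norm_ne_zero_iff.1 (by rw [hen]; exact one_ne_zero)
  have hx0 : x ≠ 0 := norm_ne_zero_iff.1 (by rw [hx]; exact one_ne_zero)
  have hdet : (!![x, 0, 0, 0; y, 1, 0, 0; 0, 0, e, -(e * y); 0, 0, 0, e * x] :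
      Matrix (Fin 4) (Fin 4) ℚ_[p]).det = x ^ 2 := by
    have : (!![x, 0, 0, 0; y, 1, 0, 0; 0, 0, e, -(e * y); 0, 0, 0, e * x] :
        Matrix (Fin 4) (Fin 4) ℚ_[p]) = blk p !![x, 0; y, 1] 0 0 !![e, -(e * y); 0, e * x] := by
      rw [blk_eq]; simp
    rw [this, blk, Matrix.det_reindex_self, Matrix.det_fromBlocks_zero₂₁, Matrix.det_fin_two_of,
      Matrix.det_fin_two_of]
    linear_combination x ^ 2 * he
  refine ⟨⟨⟨?_, Units.mk0 (e * x) (mul_ne_zero he0 hx0), ?_⟩, ?_, ?_⟩, ?_⟩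
  · rw [hdet]; exact (pow_ne_zero 2 hx0).isUnit
  · ext i j
    fin_cases i <;> fin_cases j <;>
      simp [Jmat, Matrix.mul_apply, Fin.sum_univ_succ] <;> ring
  · intro i j
    fin_cases i <;> fin_cases j <;> simp [hx, hy, hen]
  · rw [hdet, norm_pow, hx, one_pow]
  · simp

/-- The matrix with blocks `z = (u, v)` and `z⁻ᵀ`, when `det z = ε = ±1`. -/
def zGen (ε u u' v v' : ℚ_[p]) : Matrix (Fin 4) (Fin 4) ℚ_[p] :=
  !![u, v, 0, 0; u', v', 0, 0; 0, 0, ε * v', -(ε * u'); 0, 0, -(ε * v), ε * u]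

theorem ZV_eq_zGen (w : Option (Fin p)) :
    ∃ ε u u' : ℚ_[p], ε ^ 2 = 1 ∧ ‖u‖ ≤ 1 ∧ ‖u'‖ ≤ 1 ∧ u * dirV' p w - u' * dirV p w = ε ∧
      ZV p w = zGen p ε u u' (dirV p w) (dirV' p w) := by
  cases w with
  | some y => exact ⟨1, 1, 0, by simp, by simp, by simp, by simp [dirV, dirV'],
      by simp [ZV, Zmat, zGen, dirV, dirV']⟩
  | none => exact ⟨-1, 0, 1, by simp, by simp, by simp, by simp [dirV, dirV'],
      by simp [ZV, Zinf, zGen, dirV, dirV']⟩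

theorem Amat_zero [NeZero p] (w : Option (Fin p)) :
    Amat p (0, 0, 0) w = Jmat p * ZV p w := by
  have h : Umat p 0 0 0 = 1 := by
    ext i j
    fin_cases i <;> fin_cases j <;> simp [Umat]
  simp [Amat, h]

theorem norm_dirV_le (w : Option (Fin p)) : ‖dirV p w‖ ≤ 1 := by
  cases w with
  | some y => exact by simpa [dirV] using Padic.norm_int_le_one (p := p) y.val
  | none => simp [dirV]

theorem norm_dirV'_le (w : Option (Fin p)) : ‖dirV' p w‖ ≤ 1 := by
  cases w <;> simp [dirV']

/-- If `M = (A, B; C, D)` maps the second column of `z₁` to that of `z₂`, then `z₁⁻¹ M⁻¹ z₂` has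
the given first column. -/
theorem mul_col_eq {ε κ A B C D u u' v v' η w w' z z' : ℚ_[p]} (hε : ε ^ 2 = 1)
    (hκ : κ * (A * D - B * C) = 1) (hdε : u * v' - u' * v = ε) (hdη : w * z' - w' * z = η)
    (hz : A * v + B * v' = z) (hz' : C * v + D * v' = z') :
    A * (u * (ε * η * κ) + v * (ε * κ * (-(u' * (D * w - B * w')) + u * (A * w' - C * w)))) +
      B * (u' * (ε * η * κ) + v' * (ε * κ * (-(u' * (D * w - B * w')) + u * (A * w' - C * w))))
      = w ∧
    C * (u * (ε * η * κ) + v * (ε * κ * (-(u' * (D * w - B * w')) + u * (A * w' - C * w)))) +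
      D * (u' * (ε * η * κ) + v' * (ε * κ * (-(u' * (D * w - B * w')) + u * (A * w' - C * w))))
      = w' := by
  subst hdη hz hz'
  constructor
  · linear_combination ε * κ * w * (A * D - B * C) * hdε + ε ^ 2 * w * hκ + w * hε
  · linear_combination w' * hε + ε ^ 2 * w' * hκ + ε * κ * w' * (A * D - B * C) * hdε

/-- The intertwining identity: the torus element with parameters `X, P * Y` carries the first
representative to the second one. -/
theorem torus_intertwine (P L X Y ε u u' v v' η w w' z z' x y : ℚ_[p])
    (hε : ε ^ 2 = 1)
    (hz : X * v + P ^ 2 * Y * a * v' = z)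
    (hz' : -(Y * c * v) + (X + P * Y * b) * v' = z')
    (hw : X * (u * x + v * y) + P ^ 2 * Y * a * (u' * x + v' * y) = w)
    (hw' : -(Y * c * (u * x + v * y)) + (X + P * Y * b) * (u' * x + v' * y) = w') :
    !![X + P * Y * b, P * Y * c, 0, 0; -(P * Y * a), X, 0, 0;
        0, 0, X, -(-(P * Y * a)); 0, 0, -(P * Y * c), X + P * Y * b] *
      diagonal ![P ^ 2 * L, P * L, 1, P] * (Jmat p * zGen p ε u u' v v') *
      !![x, 0, 0, 0; y, 1, 0, 0; 0, 0, ε * η, -(ε * η * y); 0, 0, 0, ε * η * x] =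
    diagonal ![P ^ 2 * L, P * L, 1, P] * (Jmat p * zGen p η w w' z z') := by
  have hD : diagonal ![P ^ 2 * L, P * L, 1, P] =
      !![P ^ 2 * L, 0, 0, 0; 0, P * L, 0, 0; 0, 0, 1, 0; 0, 0, 0, P] := by
    ext i j
    fin_cases i <;> fin_cases j <;> rfl
  rw [hD]
  ext i j
  fin_cases i <;> fin_cases j <;>
    simp [Jmat, zGen, Matrix.mul_apply, Fin.sum_univ_succ]
  all_goals subst hz hz' hw hw'
  all_goals first
    | ring1
    | linear_combination P ^ 2 * L * η * (-(Y * c * v) + (X + P * Y * b) * v') * hε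
    | linear_combination -(P ^ 2 * L * η * (-(Y * c * (u * x + v * y)) +
        (X + P * Y * b) * (u' * x + v' * y))) * hε
    | linear_combination -(P * L * η * (X * v + P ^ 2 * Y * a * v')) * hε
    | linear_combination P * L * η * (X * (u * x + v * y) +
        P ^ 2 * Y * a * (u' * x + v' * y)) * hε

theorem lmEquiv_of_norm_besselForm [NeZero p]
    (ha : ‖a‖ ≤ 1) (hb : ‖b‖ ≤ 1) (hc : ‖c‖ ≤ 1) (l : ℤ) (m : ℕ) (v₁ v₂ : Option (Fin p))
    (h₁ : ‖besselForm p a b c ((p : ℚ_[p]) ^ m) (dirV p v₁) (dirV' p v₁)‖ = 1)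
    (h₂ : ‖besselForm p a b c ((p : ℚ_[p]) ^ m) (dirV p v₂) (dirV' p v₂)‖ = 1) :
    LMEquiv p a b c l m (Amat p (0, 0, 0) v₁) (Amat p (0, 0, 0) v₂) := by
  have hp0 : (p : ℚ_[p]) ≠ 0 := Nat.cast_ne_zero.2 (NeZero.ne p)
  obtain ⟨ε, u, u', hε, hu, hu', hdε, hZ₁⟩ := ZV_eq_zGen p v₁
  obtain ⟨η, w, w', hη, hw, hw', hdη, hZ₂⟩ := ZV_eq_zGen p v₂
  have hv := norm_dirV_le p v₁
  have hv' := norm_dirV'_le p v₁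
  have hz := norm_dirV_le p v₂
  have hz' := norm_dirV'_le p v₂
  rw [Amat_zero, Amat_zero, hZ₁, hZ₂]
  generalize dirV p v₁ = v at *
  generalize dirV' p v₁ = v' at *
  generalize dirV p v₂ = z at *
  generalize dirV' p v₂ = z' at *
  set P : ℚ_[p] := (p : ℚ_[p]) ^ m with hP
  have hPn : ‖P‖ ≤ 1 := by
    rw [hP, norm_pow]; exact pow_le_one₀ (norm_nonneg _) Padic.norm_p_lt_one.le
  obtain ⟨q, hq⟩ : ∃ q, q = besselForm p a b c P v v' := ⟨_, rfl⟩
  obtain ⟨q₂, hq₂⟩ : ∃ q, q = besselForm p a b c P z z' := ⟨_, rfl⟩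
  rw [← hq] at h₁
  rw [← hq₂] at h₂
  have hq0 : q ≠ 0 := norm_ne_zero_iff.1 (by rw [h₁]; exact one_ne_zero)
  have hq20 : q₂ ≠ 0 := norm_ne_zero_iff.1 (by rw [h₂]; exact one_ne_zero)
  unfold besselForm at hq hq₂
  obtain ⟨X, hX⟩ : ∃ X, X = (z * (-(c * v) + P * b * v') - P ^ 2 * a * v' * z') / q := ⟨_, rfl⟩
  obtain ⟨Y, hY⟩ : ∃ Y, Y = (v * z' - v' * z) / q := ⟨_, rfl⟩
  have hXq : X * q = z * (-(c * v) + P * b * v') - P ^ 2 * a * v' * z' := by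
    rw [hX]; field_simp
  have hYq : Y * q = v * z' - v' * z := by
    rw [hY]; field_simp
  have hδ : X * (X + P * Y * b) + (P * Y) ^ 2 * (a * c) = q₂ / q := by
    rw [eq_div_iff hq0]
    apply mul_left_cancel₀ hq0
    calc q * ((X * (X + P * Y * b) + (P * Y) ^ 2 * (a * c)) * q)
        = X * q * (X * q + P * (Y * q) * b) + (P * (Y * q)) ^ 2 * (a * c) := by ring
      _ = q * q₂ := by rw [hXq, hYq, hq, hq₂]; ring
  have hδ0 : X * (X + P * Y * b) + (P * Y) ^ 2 * (a * c) ≠ 0 := by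
    rw [hδ]; exact div_ne_zero hq20 hq0
  have hz1 : X * v + P ^ 2 * Y * a * v' = z := by
    apply mul_left_cancel₀ hq0
    linear_combination v * hXq + P ^ 2 * a * v' * hYq - z * hq
  have hz2 : -(Y * c * v) + (X + P * Y * b) * v' = z' := by
    apply mul_left_cancel₀ hq0
    linear_combination v' * hXq + (P * b * v' - c * v) * hYq - z' * hq
  set x : ℚ_[p] := ε * η * (q / q₂) with hx
  set y : ℚ_[p] := ε * (q / q₂) * (-(u' * ((X + P * Y * b) * w - P ^ 2 * Y * a * w')) +
    u * (X * w' - -(Y * c) * w)) with hy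
  have hqq : q / q₂ * (X * (X + P * Y * b) - P ^ 2 * Y * a * -(Y * c)) = 1 := by
    rw [div_mul_eq_mul_div, div_eq_one_iff_eq hq20, ← div_mul_cancel₀ q₂ hq0, ← hδ]
    ring
  have hcol := mul_col_eq p hε hqq hdε hdη hz1 (by linear_combination hz2)
  refine ⟨emb p !![X + P * Y * b, P * Y * c; -(P * Y * a), X] * 1,
    ⟨_, torus_mem p a b c X (P * Y) hδ0, 1, ⟨0, by simp, ?_⟩, rfl⟩,
    !![x, 0, 0, 0; y, 1, 0, 0; 0, 0, ε * η, -(ε * η * y); 0, 0, 0, ε * η * x],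
    iwahori_mem p _ _ _ (by rw [mul_pow, hε, hη, one_mul]) ?_ ?_, ?_⟩
  · rw [blk, Matrix.fromBlocks_one]; simp
  · rw [hx, norm_mul, norm_mul, norm_div, norm_one_of_sq p hε, norm_one_of_sq p hη, h₁, h₂]
    norm_num
  · have hXn : X ∈ PadicInt.subring p := by
      rw [PadicInt.mem_subring_iff, hX, norm_div, h₁, div_one]
      exact Subring.sub_mem (PadicInt.subring p)
        (mul_mem hz (add_mem (neg_mem (mul_mem hc hv)) (mul_mem (mul_mem hPn hb) hv')))
        (mul_mem (mul_mem (mul_mem (pow_mem hPn 2) ha) hv') hz')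
    have hYn : Y ∈ PadicInt.subring p := by
      rw [PadicInt.mem_subring_iff, hY, norm_div, h₁, div_one]
      exact Subring.sub_mem (PadicInt.subring p) (mul_mem hv hz') (mul_mem hv' hz)
    have hκn : q / q₂ ∈ PadicInt.subring p := by
      rw [PadicInt.mem_subring_iff, norm_div, h₁, h₂, div_one]
    exact Subring.mul_mem (PadicInt.subring p) (mul_mem (norm_one_of_sq p hε).le hκn)
      (add_mem (neg_mem (mul_mem hu' (sub_mem
        (mul_mem (add_mem hXn (mul_mem (mul_mem hPn hYn) hb)) hw)
        (mul_mem (mul_mem (mul_mem (pow_mem hPn 2) hYn) ha) hw'))))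
        (mul_mem hu (sub_mem (mul_mem hXn hw') (mul_mem (neg_mem (mul_mem hYn hc)) hw))))
  · have hh : hmat p l m = diagonal ![P ^ 2 * (p : ℚ_[p]) ^ l, P * (p : ℚ_[p]) ^ l, 1, P] := by
      rw [hmat, hP]
      have h2 : (p : ℚ_[p]) ^ (2 * (m : ℤ)) = ((p : ℚ_[p]) ^ m) ^ 2 := by
        rw [mul_comm, _root_.zpow_mul, zpow_natCast]; norm_cast
      rw [zpow_add₀ hp0, zpow_add₀ hp0, h2, zpow_natCast]
    rw [hh, mul_one, emb_eq _ _ _ _ _ (by convert hδ0 using 1; ring)]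
    apply torus_intertwine p a b c P _ X Y ε u u' v v' η w w' z z' x y hε hz1 hz2
    · exact hcol.1
    · linear_combination hcol.2

theorem norm_besselForm_of_pos
    (ha : ‖a‖ ≤ 1) (hb : ‖b‖ ≤ 1) (hc : ‖c‖ = 1) {m : ℕ} (hm : 0 < m) [NeZero p]
    {w : Option (Fin p)} (hw : w ≠ some 0) :
    ‖besselForm p a b c ((p : ℚ_[p]) ^ m) (dirV p w) (dirV' p w)‖ = 1 := by
  cases w with
  | none => simpa [besselForm, dirV, dirV'] using hc
  | some y =>
    have hy0 : y.val ≠ 0 := fun h => hw (congrArg some (Fin.ext h))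
    have hy : ‖(y.val : ℚ_[p])‖ = 1 := by
      exact Padic.norm_natCast_eq_one_iff.2
        ((Fact.out : p.Prime).coprime_iff_not_dvd.2 fun h =>
          hy0 (Nat.eq_zero_of_dvd_of_lt h y.isLt))
    have hP : ‖(p : ℚ_[p]) ^ m‖ < 1 := by
      rw [norm_pow]; exact pow_lt_one₀ (norm_nonneg _) Padic.norm_p_lt_one hm.ne'
    simp only [besselForm, dirV, dirV']
    generalize (p : ℚ_[p]) ^ m = P at *
    generalize (y.val : ℚ_[p]) = t at *
    have h1 : ‖-(c * t ^ 2)‖ = 1 := by simp [hc, hy]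
    have h2 : ‖P * (b * t - P * a)‖ < 1 := by
      rw [norm_mul]
      exact mul_lt_one_of_nonneg_of_lt_one_left (norm_nonneg _) hP
        (Subring.sub_mem (PadicInt.subring p) (mul_mem hb hy.le) (mul_mem hP.le ha))
    rw [show -(c * t ^ 2) + P * b * t * 1 - P ^ 2 * a * 1 ^ 2 =
      -(c * t ^ 2) + P * (b * t - P * a) by ring,
      IsUltrametricDist.norm_add_eq_max_of_norm_ne_norm (by rw [h1]; exact h2.ne'), h1,
      max_eq_left h2.le]

/-- A quadratic polynomial with unit discriminant and a root modulo `p` has square discriminant. -/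
theorem exists_sq_eq_discrim (a b c t : ℤ_[p]) (hd : ‖b ^ 2 - 4 * a * c‖ = 1)
    (ht : ‖c * t ^ 2 - b * t + a‖ < 1) : ∃ z : ℤ_[p], z ^ 2 = b ^ 2 - 4 * a * c := by
  open Polynomial in
  obtain ⟨F, hF⟩ : ∃ F : ℤ_[p][X], F = C c * X ^ 2 - C b * X + C a := ⟨_, rfl⟩
  have hev (s : ℤ_[p]) : Polynomial.aeval s F = c * s ^ 2 - b * s + a := by simp [hF]
  have hder : Polynomial.aeval t (Polynomial.derivative F) = 2 * c * t - b := by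
    simp [hF]; ring
  have h4 : ‖4 * c * (c * t ^ 2 - b * t + a)‖ < 1 := by
    rw [norm_mul]
    exact mul_lt_one_of_nonneg_of_lt_one_right (PadicInt.norm_le_one _) (norm_nonneg _) ht
  have hsq : ‖2 * c * t - b‖ ^ 2 = 1 := by
    rw [← norm_pow, show (2 * c * t - b) ^ 2 =
      (b ^ 2 - 4 * a * c) + 4 * c * (c * t ^ 2 - b * t + a) by ring,
      IsUltrametricDist.norm_add_eq_max_of_norm_ne_norm (by rw [hd]; exact h4.ne'), hd,
      max_eq_left h4.le]
  obtain ⟨z, hz, -⟩ := hensels_lemma (F := F) (a := t) (by rw [hev, hder, hsq]; exact ht)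
  rw [hev] at hz
  exact ⟨2 * c * z - b, by linear_combination 4 * c * hz⟩

theorem norm_besselForm_zero
    (ha : ‖a‖ ≤ 1) (hb : ‖b‖ ≤ 1) (hc : ‖c‖ = 1) (hd : ‖b ^ 2 - 4 * a * c‖ = 1)
    (hnsq : ∀ z : ℚ_[p], z ^ 2 ≠ b ^ 2 - 4 * a * c) (w : Option (Fin p)) :
    ‖besselForm p a b c ((p : ℚ_[p]) ^ 0) (dirV p w) (dirV' p w)‖ = 1 := by
  cases w with
  | none => simpa [besselForm, dirV, dirV'] using hc
  | some y =>
    obtain ⟨a, rfl⟩ : ∃ a' : ℤ_[p], (a' : ℚ_[p]) = a := ⟨⟨a, ha⟩, rfl⟩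
    obtain ⟨b, rfl⟩ : ∃ b' : ℤ_[p], (b' : ℚ_[p]) = b := ⟨⟨b, hb⟩, rfl⟩
    obtain ⟨c, rfl⟩ : ∃ c' : ℤ_[p], (c' : ℚ_[p]) = c := ⟨⟨c, hc.le⟩, rfl⟩
    have heq : besselForm p (a : ℚ_[p]) b c ((p : ℚ_[p]) ^ 0) (dirV p (some y))
        (dirV' p (some y)) = ((-(c * y.val ^ 2 - b * y.val + a) : ℤ_[p]) : ℚ_[p]) := by
      simp only [besselForm, dirV, dirV']
      push_cast
      ring
    rw [heq, PadicInt.padic_norm_e_of_padicInt, norm_neg]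
    refine le_antisymm (PadicInt.norm_le_one _) (not_lt.1 fun h => ?_)
    obtain ⟨z, hz⟩ := exists_sq_eq_discrim p a b c y.val
      (by rw [PadicInt.norm_def]; push_cast; exact hd) h
    exact hnsq z (by have := congrArg ((↑) : ℤ_[p] → ℚ_[p]) hz; push_cast at this; exact this)

theorem classA_equivalent [NeZero p]
    (ha : ‖a‖ = 1) (hb : ‖b‖ ≤ 1) (hc : ‖c‖ = 1)
    (hd : ‖b ^ 2 - 4 * a * c‖ = 1)
    (hnsq : ∀ z : ℚ_[p], z ^ 2 ≠ b ^ 2 - 4 * a * c)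
    (l : ℤ) (m : ℕ) :
    (0 < m → ∀ v₁ v₂ : Option (Fin p), v₁ ≠ some 0 → v₂ ≠ some 0 →
      LMEquiv p a b c l m (Amat p (0,0,0) v₁) (Amat p (0,0,0) v₂)) ∧
    (∀ v₁ v₂ : Option (Fin p),
      LMEquiv p a b c l 0 (Amat p (0,0,0) v₁) (Amat p (0,0,0) v₂)) := by
  have reduce : ∀ (m : ℕ) (v₁ v₂ : Option (Fin p)),
      ‖besselForm p a b c ((p : ℚ_[p]) ^ m) (dirV p v₁) (dirV' p v₁)‖ = 1 →
      ‖besselForm p a b c ((p : ℚ_[p]) ^ m) (dirV p v₂) (dirV' p v₂)‖ = 1 →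
      LMEquiv p a b c l m (Amat p (0,0,0) v₁) (Amat p (0,0,0) v₂) :=
    fun m v₁ v₂ h₁ h₂ => lmEquiv_of_norm_besselForm p a b c ha.le hb hc.le l m v₁ v₂ h₁ h₂
  refine ⟨fun hm v₁ v₂ h₁ h₂ => reduce m v₁ v₂ ?_ ?_, fun v₁ v₂ => reduce 0 v₁ v₂ ?_ ?_⟩
  · exact norm_besselForm_of_pos p a b c ha.le hb hc hm h₁
  · exact norm_besselForm_of_pos p a b c ha.le hb hc hm h₂
  · exact norm_besselForm_zero p a b c ha.le hb hc hd hnsq v₁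
  · exact norm_besselForm_zero p a b c ha.le hb hc hd hnsq v₂
end
end

section
/- For every l ∈ ℤ, every integer m ≥ 0, every λ ∈ Y and every y ∈ {(−λ) mod p, ∞}, the matrix B_{(1, λ, λ² mod p)}^y is (l,m)-equivalent to B_{(1,0,0)}^0 or to B_{(1,0,0)}^∞. -/
open Matrix

noncomputable section

variable (p : ℕ) [Fact p.Prime]

variable (a b c : ℚ_[p])

section Integral
variable {R : Type*} [CommRing R]

/-- The symplectic form matrix `J` over an arbitrary commutative ring. -/
def sympJ (R : Type*) [CommRing R] : Matrix (Fin 4) (Fin 4) R :=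
  !![0,0,1,0; 0,0,0,1; -1,0,0,0; 0,-1,0,0]

/-- The lower triangular unipotent with symmetric lower left block `(x, y; y, z)`. -/
def lowerUnip (x y z : R) : Matrix (Fin 4) (Fin 4) R :=
  !![1,0,0,0; 0,1,0,0; x,y,1,0; y,z,0,1]

/-- The upper triangular unipotent with symmetric upper right block `(x, y; y, z)`. -/
def upperUnip (x y z : R) : Matrix (Fin 4) (Fin 4) R :=
  !![1,0,x,y; 0,1,y,z; 0,0,1,0; 0,0,0,1]

/-- The Levi element with upper left block `(s, t; u, v)` and similitude `s * v - t * u`. -/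
def levi (s t u v : R) : Matrix (Fin 4) (Fin 4) R :=
  !![s,t,0,0; u,v,0,0; 0,0,v,-u; 0,0,-t,s]

/-- The matrix `Z_y` over an arbitrary commutative ring. -/
def shear (y : R) : Matrix (Fin 4) (Fin 4) R :=
  !![1,y,0,0; 0,1,0,0; 0,0,1,0; 0,0,-y,1]

/-- The matrix `Z_∞` over an arbitrary commutative ring. -/
def weylSwap (R : Type*) [CommRing R] : Matrix (Fin 4) (Fin 4) R :=
  !![0,1,0,0; 1,0,0,0; 0,0,0,1; 0,0,1,0]

/-- The matrix `g` is a symplectic similitude with multiplier `μ`. -/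
def IsSimilitude (μ : R) (g : Matrix (Fin 4) (Fin 4) R) : Prop :=
  gᵀ * sympJ R * g = μ • sympJ R

theorem IsSimilitude.mul {μ ν : R} {g h : Matrix (Fin 4) (Fin 4) R}
    (hg : IsSimilitude μ g) (hh : IsSimilitude ν h) : IsSimilitude (μ * ν) (g * h) := by
  unfold IsSimilitude at *
  calc (g * h)ᵀ * sympJ R * (g * h) = hᵀ * (gᵀ * sympJ R * g) * h := by
        simp only [transpose_mul, Matrix.mul_assoc]
    _ = (μ * ν) • sympJ R := by
        rw [hg, Matrix.mul_smul, Matrix.smul_mul, hh, smul_smul]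

theorem isSimilitude_lowerUnip (x y z : R) : IsSimilitude 1 (lowerUnip x y z) := by
  ext i j
  fin_cases i <;> fin_cases j <;>
    simp [sympJ, lowerUnip, Matrix.mul_apply, Fin.sum_univ_four]

theorem isSimilitude_upperUnip (x y z : R) : IsSimilitude 1 (upperUnip x y z) := by
  ext i j
  fin_cases i <;> fin_cases j <;>
    simp [sympJ, upperUnip, Matrix.mul_apply, Fin.sum_univ_four]

theorem isSimilitude_levi (s t u v : R) : IsSimilitude (s * v - t * u) (levi s t u v) := by
  ext i j
  fin_cases i <;> fin_cases j <;>
    simp [sympJ, levi, Matrix.mul_apply, Fin.sum_univ_four] <;> ring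

theorem isSimilitude_shear (y : R) : IsSimilitude 1 (shear y) := by
  ext i j
  fin_cases i <;> fin_cases j <;>
    simp [sympJ, shear, Matrix.mul_apply, Fin.sum_univ_four]

theorem isSimilitude_weylSwap : IsSimilitude 1 (weylSwap R) := by
  ext i j
  fin_cases i <;> fin_cases j <;>
    simp [sympJ, weylSwap, Matrix.mul_apply, Fin.sum_univ_four]

theorem det_sympJ : (sympJ R).det = 1 := by
  simp [sympJ, Matrix.det_succ_row_zero, Fin.sum_univ_succ, Fin.succAbove]

theorem IsSimilitude.det_sq {μ : R} {g : Matrix (Fin 4) (Fin 4) R} (hg : IsSimilitude μ g) :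
    g.det ^ 2 = μ ^ 4 := by
  have := congrArg Matrix.det hg
  simp only [Matrix.det_mul, Matrix.det_transpose, Matrix.det_smul, det_sympJ] at this
  simpa [sq] using this

/-- The vanishing pattern defining the Iwahori subgroup modulo `p`. -/
def HasIwahoriZeros (g : Matrix (Fin 4) (Fin 4) R) : Prop :=
  g 0 1 = 0 ∧ g 2 0 = 0 ∧ g 2 1 = 0 ∧ g 3 0 = 0 ∧ g 3 1 = 0 ∧ g 3 2 = 0

/-- The matrix `U(-Y) · diag(C, det(C) · C⁻ᵀ)`, inverse to the element of the Bessel group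
(conjugated by `h(l,m)`) that realises the equivalences, for `Y = (-x, -y; -y, 0)`. -/
def besselInv (a b P lam t x y : R) : Matrix (Fin 4) (Fin 4) R :=
  upperUnip x y 0 * levi (1 - P * t * b) (-lam) (a * P ^ 2 * t) 1

/-- The candidate Iwahori element, up to the factors `Z_y`. -/
def iwahoriCore (a b P lam r t x y : R) : Matrix (Fin 4) (Fin 4) R :=
  lowerUnip 1 lam r * besselInv a b P lam t x y * lowerUnip (-1) 0 0

theorem isSimilitude_iwahoriCore (a b P lam r t x y : R) :
    IsSimilitude (1 - P * t * b + a * P ^ 2 * t * lam) (iwahoriCore a b P lam r t x y) := by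
  have h := ((isSimilitude_lowerUnip 1 lam r).mul ((isSimilitude_upperUnip x y 0).mul
    (isSimilitude_levi (1 - P * t * b) (-lam) (a * P ^ 2 * t) 1))).mul
    (isSimilitude_lowerUnip (-1) 0 0)
  rw [show 1 * (1 * ((1 - P * t * b) * 1 - -lam * (a * P ^ 2 * t))) * 1 =
    1 - P * t * b + a * P ^ 2 * t * lam by ring] at h
  exact h

theorem hasIwahoriZeros_shear (a b P lam t : R) :
    HasIwahoriZeros (shear lam * iwahoriCore a b P lam (lam ^ 2) t
      (a * P ^ 2 * t * lam - P * t * b) 0) := by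
  refine ⟨?_, ?_, ?_, ?_, ?_, ?_⟩ <;>
  simp [shear, iwahoriCore, besselInv, lowerUnip, upperUnip, levi, Matrix.mul_apply,
    Fin.sum_univ_four] <;> ring

theorem hasIwahoriZeros_weylSwap (a b P lam t : R) :
    HasIwahoriZeros (weylSwap R * iwahoriCore a b P lam (lam ^ 2) t
      (-(P * t * b) - a * P ^ 2 * t * lam) (a * P ^ 2 * t) * weylSwap R) := by
  refine ⟨?_, ?_, ?_, ?_, ?_, ?_⟩ <;>
  simp [weylSwap, iwahoriCore, besselInv, lowerUnip, upperUnip, levi, Matrix.mul_apply,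
    Fin.sum_univ_four] <;> ring

section Map
variable {R' : Type*} [CommRing R'] (f : R →+* R')

theorem map_shear (y : R) : (shear y).map f = shear (f y) := by
  ext i j; fin_cases i <;> fin_cases j <;> simp [shear]

theorem map_weylSwap : (weylSwap R).map f = weylSwap R' := by
  ext i j; fin_cases i <;> fin_cases j <;> simp [weylSwap]

theorem map_sympJ : (sympJ R).map f = sympJ R' := by
  ext i j; fin_cases i <;> fin_cases j <;> simp [sympJ]

theorem map_lowerUnip (x y z : R) :
    (lowerUnip x y z).map f = lowerUnip (f x) (f y) (f z) := by
  ext i j; fin_cases i <;> fin_cases j <;> simp [lowerUnip]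

theorem map_upperUnip (x y z : R) :
    (upperUnip x y z).map f = upperUnip (f x) (f y) (f z) := by
  ext i j; fin_cases i <;> fin_cases j <;> simp [upperUnip]

theorem map_levi (s t u v : R) : (levi s t u v).map f = levi (f s) (f t) (f u) (f v) := by
  ext i j; fin_cases i <;> fin_cases j <;> simp [levi]

theorem map_iwahoriCore (a b P lam r t x y : R) :
    (iwahoriCore a b P lam r t x y).map f =
      iwahoriCore (f a) (f b) (f P) (f lam) (f r) (f t) (f x) (f y) := by
  simp [iwahoriCore, besselInv, Matrix.map_mul, map_lowerUnip, map_upperUnip, map_levi]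

theorem IsSimilitude.map {μ : R} {g : Matrix (Fin 4) (Fin 4) R} (hg : IsSimilitude μ g) :
    IsSimilitude (f μ) (g.map f) := by
  have h := congrArg (fun M => M.map f) hg
  simp only [Matrix.map_mul, Matrix.transpose_map, map_sympJ] at h
  rw [IsSimilitude, h, ← map_sympJ f]
  ext i j; simp

end Map
end Integral

/-- The inclusion of `ℤ_p` in `ℚ_p` as matrices. -/
abbrev toRat (g : Matrix (Fin 4) (Fin 4) ℤ_[p]) : Matrix (Fin 4) (Fin 4) ℚ_[p] :=
  g.map (PadicInt.Coe.ringHom (p := p))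

theorem coe_ringHom_apply (x : ℤ_[p]) : PadicInt.Coe.ringHom x = (x : ℚ_[p]) := rfl

theorem norm_lt_one_of_toZMod_eq_zero {x : ℤ_[p]} (hx : PadicInt.toZMod x = 0) :
    ‖(x : ℚ_[p])‖ < 1 := by
  rw [← RingHom.mem_ker, PadicInt.ker_toZMod, PadicInt.maximalIdeal_eq_span_p,
    Ideal.mem_span_singleton, ← PadicInt.norm_lt_one_iff_dvd] at hx
  exact hx

theorem toRat_mem_Ip {μ : ℤ_[p]} (hμ : IsUnit μ) {g : Matrix (Fin 4) (Fin 4) ℤ_[p]}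
    (hg : IsSimilitude μ g) (hz : HasIwahoriZeros (g.map (PadicInt.toZMod (p := p)))) :
    toRat p g ∈ Ip p := by
  have hdet : IsUnit g.det := by
    have h := hg.det_sq ▸ hμ.pow 4
    exact (isUnit_pow_iff two_ne_zero).1 h
  have hdet' : (toRat p g).det = (g.det : ℚ_[p]) :=
    (RingHom.map_det (PadicInt.Coe.ringHom (p := p)) g).symm
  obtain ⟨h1, h2, h3, h4, h5, h6⟩ := hz
  refine ⟨⟨⟨?_, (hμ.map (PadicInt.Coe.ringHom (p := p))).unit, ?_⟩, ?_, ?_⟩,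
    norm_lt_one_of_toZMod_eq_zero p h1, norm_lt_one_of_toZMod_eq_zero p h2,
    norm_lt_one_of_toZMod_eq_zero p h3, norm_lt_one_of_toZMod_eq_zero p h4,
    norm_lt_one_of_toZMod_eq_zero p h5, norm_lt_one_of_toZMod_eq_zero p h6⟩
  · rw [hdet']
    exact hdet.map (PadicInt.Coe.ringHom (p := p))
  · exact hg.map (PadicInt.Coe.ringHom (p := p))
  · intro i j
    exact PadicInt.norm_le_one (g i j)
  · rw [hdet']
    exact PadicInt.isUnit_iff.1 hdet

open Polynomial in
theorem isUnit_one_sub_add {a b c : ℤ_[p]} (hd : IsUnit (b ^ 2 - 4 * a * c))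
    (hnsq : ∀ z : ℤ_[p], z ^ 2 ≠ b ^ 2 - 4 * a * c) (y : ℤ_[p]) :
    IsUnit (1 - b * y + a * c * y ^ 2) := by
  by_contra h
  rw [← mem_nonunits_iff, PadicInt.mem_nonunits] at h
  let F : ℤ_[p][X] := C 1 - C b * X + C (a * c) * X ^ 2
  have hF (z : ℤ_[p]) : F.eval z = 1 - b * z + a * c * z ^ 2 := by simp [F]
  have hF' (z : ℤ_[p]) : F.derivative.eval z = 2 * a * c * z - b := by
    simp [F]; ring
  have hsq : (2 * a * c * y - b) ^ 2 =
      (b ^ 2 - 4 * a * c) + 4 * a * c * (1 - b * y + a * c * y ^ 2) := by ring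
  have hlt : ‖4 * a * c * (1 - b * y + a * c * y ^ 2)‖ < 1 := by
    rw [norm_mul]
    exact lt_of_le_of_lt (mul_le_of_le_one_left (norm_nonneg _) (PadicInt.norm_le_one _)) h
  have hone : ‖(2 * a * c * y - b) ^ 2‖ = 1 := by
    rw [PadicInt.isUnit_iff] at hd
    rw [hsq, PadicInt.norm_add_eq_max_of_ne (by rw [hd]; exact hlt.ne'), hd]
    exact max_eq_left hlt.le
  obtain ⟨z, hz, -⟩ := hensels_lemma (F := F) (a := y) (by
    simp only [Polynomial.coe_aeval_eq_eval, hF, hF', ← norm_pow, hone]; exact h)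
  simp only [Polynomial.coe_aeval_eq_eval, hF] at hz
  refine hnsq (2 * a * c * z - b) ?_
  linear_combination 4 * a * c * hz


theorem hmat_eq (l : ℤ) (m : ℕ) :
    hmat p l m = !![((p : ℚ_[p]) ^ m) ^ 2 * (p : ℚ_[p]) ^ l, 0, 0, 0;
      0, (p : ℚ_[p]) ^ m * (p : ℚ_[p]) ^ l, 0, 0; 0, 0, 1, 0; 0, 0, 0, (p : ℚ_[p]) ^ m] := by
  have hp : (p : ℚ_[p]) ≠ 0 := Nat.cast_ne_zero.2 (Fact.out : p.Prime).ne_zero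
  rw [hmat, zpow_add₀ hp, zpow_add₀ hp, _root_.zpow_mul', zpow_natCast, zpow_ofNat]
  ext i j
  fin_cases i <;> fin_cases j <;> rfl

theorem exists_mem_Rgrp_mul_besselInv {a b c lam t : ℚ_[p]} (l : ℤ) (m : ℕ) (x y : ℚ_[p])
    (ht : c * t = lam)
    (hδ : 1 - (p : ℚ_[p]) ^ m * t * b + a * ((p : ℚ_[p]) ^ m) ^ 2 * t * lam ≠ 0) :
    ∃ r ∈ Rgrp p a b c,
      r * hmat p l m * besselInv a b ((p : ℚ_[p]) ^ m) lam t x y = hmat p l m := by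
  rw [hmat_eq]
  generalize (p : ℚ_[p]) ^ l = L
  generalize (p : ℚ_[p]) ^ m = P at hδ ⊢
  obtain ⟨e, he⟩ : ∃ e : ℚ_[p], e * (1 - P * t * b + a * P ^ 2 * t * lam) = 1 :=
    ⟨_, inv_mul_cancel₀ hδ⟩
  let T : Matrix (Fin 2) (Fin 2) ℚ_[p] :=
    !![e, e * (P * lam); e * (-a * P * t), e * (1 - P * t * b)]
  have hdet : T.det = e := by
    simp only [T, Matrix.det_fin_two_of]
    linear_combination e * he
  have hinv : T⁻¹ = !![1 - P * t * b, -(P * lam); a * P * t, 1] := by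
    refine Matrix.inv_eq_left_inv ?_
    ext i j
    fin_cases i <;> fin_cases j <;> simp [T, Matrix.mul_apply] <;>
      first | ring1 | linear_combination he
  refine ⟨_, ⟨T, ⟨?_, ?_⟩, _, ⟨!![-(L * P ^ 2 * x), -(L * P * y); -(L * P * y), 0], ?_, rfl⟩,
    rfl⟩, ?_⟩
  · rw [hdet]
    exact IsUnit.of_mul_eq_one _ he
  · rw [hdet]
    subst ht
    ext i j
    fin_cases i <;> fin_cases j <;> simp [T, Smat, Matrix.mul_apply, Fin.sum_univ_two]
    · linear_combination e * a * he
    · linear_combination e * b / 2 * he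
    · linear_combination e * b / 2 * he
    · linear_combination e * c * he
  · ext i j
    fin_cases i <;> fin_cases j <;> rfl
  · rw [emb, hdet, hinv, blk_eq, blk_eq]
    ext i j
    fin_cases i <;> fin_cases j <;>
      simp [T, besselInv, upperUnip, levi, Matrix.mul_apply, Fin.sum_univ_four] <;>
      first
        | ring1
        | linear_combination (P ^ 2 * L) * he
        | linear_combination (P * L) * he
        | linear_combination he
        | linear_combination (P) * he

theorem Jmat_mul_Umat_mul_Jmat (n q r : ℚ_[p]) :
    Jmat p * Umat p n q r * Jmat p = -lowerUnip (-n) (-q) (-r) := by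
  ext i j
  fin_cases i <;> fin_cases j <;>
    simp [Jmat, Umat, lowerUnip, Matrix.mul_apply, Fin.sum_univ_four]

theorem lowerUnip_neg_mul {R : Type*} [CommRing R] (x y z : R) :
    lowerUnip (-x) (-y) (-z) * lowerUnip x y z = 1 := by
  ext i j
  fin_cases i <;> fin_cases j <;>
    simp [lowerUnip, Matrix.mul_apply, Fin.sum_univ_four]

theorem shear_mul_shear_neg {R : Type*} [CommRing R] (y : R) : shear y * shear (-y) = 1 := by
  ext i j
  fin_cases i <;> fin_cases j <;>
    simp [shear, Matrix.mul_apply, Fin.sum_univ_four]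

theorem weylSwap_mul_self {R : Type*} [CommRing R] : weylSwap R * weylSwap R = 1 := by
  ext i j
  fin_cases i <;> fin_cases j <;>
    simp [weylSwap, Matrix.mul_apply, Fin.sum_univ_four]

theorem shear_zero {R : Type*} [CommRing R] : shear (0 : R) = 1 := by
  ext i j
  fin_cases i <;> fin_cases j <;> simp [shear]

theorem lmEquiv_of_mem_Ip {a b c lam t : ℚ_[p]} (l : ℤ) (m : ℕ) {r x y : ℚ_[p]}
    {Z W Z₀ : Matrix (Fin 4) (Fin 4) ℚ_[p]} (ht : c * t = lam)
    (hδ : 1 - (p : ℚ_[p]) ^ m * t * b + a * ((p : ℚ_[p]) ^ m) ^ 2 * t * lam ≠ 0)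
    (hW : Z * W = 1)
    (hk : W * iwahoriCore a b ((p : ℚ_[p]) ^ m) lam r t x y * Z₀ ∈ Ip p) :
    LMEquiv p a b c l m (Jmat p * Umat p 1 lam r * Jmat p * Z)
      (Jmat p * Umat p 1 0 0 * Jmat p * Z₀) := by
  obtain ⟨ρ, hρ, h⟩ := exists_mem_Rgrp_mul_besselInv p l m x y ht hδ
  refine ⟨ρ, hρ, _, hk, ?_⟩
  rw [Jmat_mul_Umat_mul_Jmat, Jmat_mul_Umat_mul_Jmat, iwahoriCore, neg_zero]
  calc _ = -(ρ * hmat p l m * (lowerUnip (-1) (-lam) (-r) * (Z * W) * lowerUnip 1 lam r) *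
        besselInv a b ((p : ℚ_[p]) ^ m) lam t x y * lowerUnip (-1) 0 0 * Z₀) := by
        simp only [Matrix.mul_assoc, Matrix.neg_mul, Matrix.mul_neg]
    _ = -(ρ * hmat p l m * besselInv a b ((p : ℚ_[p]) ^ m) lam t x y *
        lowerUnip (-1) 0 0 * Z₀) := by
        rw [hW, Matrix.mul_one, lowerUnip_neg_mul, Matrix.mul_one]
    _ = _ := by
        rw [h]
        simp only [Matrix.mul_assoc, Matrix.neg_mul, Matrix.mul_neg]

theorem classB_parabola_equivalent [NeZero p]
    (ha : ‖a‖ = 1) (hb : ‖b‖ ≤ 1) (hc : ‖c‖ = 1)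
    (hd : ‖b ^ 2 - 4 * a * c‖ = 1)
    (hnsq : ∀ z : ℚ_[p], z ^ 2 ≠ b ^ 2 - 4 * a * c)
    (l : ℤ) (m : ℕ) (lam : Fin p) (v : Option (Fin p))
    (hv : v = some (-lam) ∨ v = none) :
    LMEquiv p a b c l m (Bmat p (1, lam, lam * lam) v) (Bmat p (1, 0, 0) (some 0)) ∨
    LMEquiv p a b c l m (Bmat p (1, lam, lam * lam) v) (Bmat p (1, 0, 0) none) := by
  obtain ⟨a, rfl⟩ : ∃ z : ℤ_[p], (z : ℚ_[p]) = a := ⟨⟨a, ha.le⟩, rfl⟩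
  obtain ⟨b, rfl⟩ : ∃ z : ℤ_[p], (z : ℚ_[p]) = b := ⟨⟨b, hb⟩, rfl⟩
  obtain ⟨c, rfl⟩ : ∃ z : ℤ_[p], (z : ℚ_[p]) = c := ⟨⟨c, hc.le⟩, rfl⟩
  obtain ⟨c, rfl⟩ := PadicInt.isUnit_iff.2 hc
  have hδ (y : ℤ_[p]) : IsUnit (1 - b * y + a * c * y ^ 2) := by
    refine isUnit_one_sub_add p (PadicInt.isUnit_iff.2 ?_) (fun z hz => hnsq z ?_) y
    · exact_mod_cast hd
    · exact_mod_cast congrArg ((↑) : ℤ_[p] → ℚ_[p]) hz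
  set μ : ℤ_[p] := (lam.val : ℤ_[p]) with hμ
  set ρ : ℤ_[p] := ((lam * lam : Fin p).val : ℤ_[p]) with hρ
  obtain ⟨t, ht⟩ : ∃ t : ℤ_[p], c * t = μ := ⟨↑c⁻¹ * μ, by simp⟩
  have hunit : IsUnit (1 - (p : ℤ_[p]) ^ m * t * b + a * ((p : ℤ_[p]) ^ m) ^ 2 * t * μ) := by
    convert hδ ((p : ℤ_[p]) ^ m * t) using 1
    rw [← ht]; ring
  have hne : 1 - (p : ℚ_[p]) ^ m * (t : ℚ_[p]) * (b : ℚ_[p]) +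
      (a : ℚ_[p]) * ((p : ℚ_[p]) ^ m) ^ 2 * (t : ℚ_[p]) * (μ : ℚ_[p]) ≠ 0 := by
    have := (hunit.map (PadicInt.Coe.ringHom (p := p))).ne_zero
    simpa [coe_ringHom_apply] using this
  have ht' : ((c : ℤ_[p]) : ℚ_[p]) * (t : ℚ_[p]) = (μ : ℚ_[p]) := by exact_mod_cast congrArg _ ht
  have hρ' : PadicInt.toZMod ρ = PadicInt.toZMod μ ^ 2 := by
    simp [hρ, hμ, Fin.val_mul, sq]
  have h1 : ((1 : Fin p).val : ℚ_[p]) = 1 := by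
    rw [Fin.val_one', Nat.mod_eq_of_lt (Fact.out : p.Prime).one_lt, Nat.cast_one]
  have h0 : ((0 : Fin p).val : ℚ_[p]) = 0 := by simp
  have hμ' : (lam.val : ℚ_[p]) = (μ : ℚ_[p]) := by simp [hμ]
  have hρ'' : ((lam * lam : Fin p).val : ℚ_[p]) = (ρ : ℚ_[p]) := by simp [hρ]
  simp only [Bmat, h1, h0, hμ', hρ'']
  rcases hv with rfl | rfl
  · left
    set ν : ℤ_[p] := ((-lam : Fin p).val : ℤ_[p]) with hν
    have hν' : PadicInt.toZMod (-ν) = PadicInt.toZMod μ := by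
      have : ((-lam + lam : Fin p).val : ZMod p) = 0 := by simp
      rw [Fin.val_add, ZMod.natCast_mod, Nat.cast_add] at this
      rw [map_neg, hν, hμ, map_natCast, map_natCast]
      linear_combination -this
    have hmem := toRat_mem_Ip p hunit
      (g := shear (-ν) * iwahoriCore a b ((p : ℤ_[p]) ^ m) μ ρ t
        (a * ((p : ℤ_[p]) ^ m) ^ 2 * t * μ - (p : ℤ_[p]) ^ m * t * b) 0) ?_ ?_
    · refine lmEquiv_of_mem_Ip p l m (W := shear (-(ν : ℚ_[p]))) ht' hne ?_ ?_
        (x := (a : ℚ_[p]) * ((p : ℚ_[p]) ^ m) ^ 2 * t * μ - (p : ℚ_[p]) ^ m * t * b) (y := 0)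
      · convert shear_mul_shear_neg (ν : ℚ_[p]) using 2
        simp [ZV, Zmat, shear, hν]
      · have hZ : ZV p (some 0) = 1 := by
          rw [← shear_zero]
          simp [ZV, Zmat, shear]
        rw [hZ, Matrix.mul_one]
        simpa [toRat, coe_ringHom_apply, Matrix.map_mul, map_shear, map_iwahoriCore] using hmem
    · simpa using (isSimilitude_shear (-ν)).mul (isSimilitude_iwahoriCore a b _ μ ρ t _ _)
    · rw [Matrix.map_mul, map_shear, map_iwahoriCore, hν', hρ']
      simpa using hasIwahoriZeros_shear (R := ZMod p) _ _ _ _ _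
  · right
    have hmem := toRat_mem_Ip p hunit
      (g := weylSwap _ * iwahoriCore a b ((p : ℤ_[p]) ^ m) μ ρ t
        (-((p : ℤ_[p]) ^ m * t * b) - a * ((p : ℤ_[p]) ^ m) ^ 2 * t * μ)
        (a * ((p : ℤ_[p]) ^ m) ^ 2 * t) * weylSwap _) ?_ ?_
    · refine lmEquiv_of_mem_Ip p l m (W := weylSwap _) ht' hne weylSwap_mul_self ?_
        (Z₀ := weylSwap _) (x := -((p : ℚ_[p]) ^ m * t * b) - (a : ℚ_[p]) * ((p : ℚ_[p]) ^ m) ^ 2 * t * μ)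
        (y := (a : ℚ_[p]) * ((p : ℚ_[p]) ^ m) ^ 2 * t)
      simpa [toRat, coe_ringHom_apply, Matrix.map_mul, map_weylSwap, map_iwahoriCore] using hmem
    · simpa using (isSimilitude_weylSwap.mul
        (isSimilitude_iwahoriCore a b _ μ ρ t _ _)).mul isSimilitude_weylSwap
    · rw [Matrix.map_mul, Matrix.map_mul, map_weylSwap, map_iwahoriCore, hρ']
      simpa using hasIwahoriZeros_weylSwap (R := ZMod p) _ _ _ _ _
end
end

section
/- For every l ∈ ℤ and every integer m ≥ 0, no two distinct elements of T_m are (l,m)-equivalent. -/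
open Matrix

noncomputable section

variable (p : ℕ) [Fact p.Prime]

variable (a b c : ℚ_[p])

/-- `t₁ = B_{(1,0,0)}^0`. -/
def t1 : Matrix (Fin 4) (Fin 4) ℚ_[p] := Jmat p * Umat p 1 0 0 * Jmat p * Zmat p 0
/-- `t₂ = B_{(1,0,0)}^∞`. -/
def t2 : Matrix (Fin 4) (Fin 4) ℚ_[p] := Jmat p * Umat p 1 0 0 * Jmat p * Zinf p
/-- `t₃ = B_{(0,0,1)}^0`. -/
def t3 : Matrix (Fin 4) (Fin 4) ℚ_[p] := Jmat p * Umat p 0 0 1 * Jmat p * Zmat p 0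
/-- `t₄ = B_{(0,0,1)}^∞`. -/
def t4 : Matrix (Fin 4) (Fin 4) ℚ_[p] := Jmat p * Umat p 0 0 1 * Jmat p * Zinf p
/-- `t₅ = B_{(0,0,0)}^0`. -/
def t5 : Matrix (Fin 4) (Fin 4) ℚ_[p] := Jmat p * Umat p 0 0 0 * Jmat p * Zmat p 0
/-- `t₆ = B_{(0,0,0)}^∞`. -/
def t6 : Matrix (Fin 4) (Fin 4) ℚ_[p] := Jmat p * Umat p 0 0 0 * Jmat p * Zinf p
/-- `t₇ = A_{(0,0,0)}^0`. -/
def t7 : Matrix (Fin 4) (Fin 4) ℚ_[p] := Umat p 0 0 0 * Jmat p * Zmat p 0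
/-- `t₈ = A_{(0,0,0)}^∞`. -/
def t8 : Matrix (Fin 4) (Fin 4) ℚ_[p] := Umat p 0 0 0 * Jmat p * Zinf p

/-- `T_m`: `{t₁,…,t₈}` if `m > 0`, and `{t₁, t₂, t₅, t₇}` if `m = 0`. -/
def TsetM (m : ℕ) : Set (Matrix (Fin 4) (Fin 4) ℚ_[p]) :=
  if m = 0 then {t1 p, t2 p, t5 p, t7 p}
  else {t1 p, t2 p, t3 p, t4 p, t5 p, t6 p, t7 p, t8 p}

section BruhatPosition

variable {F : Type*} [Field F]

/-- The vanishing conditions on the lower two rows of a matrix that only depend on its double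
coset for the Siegel parabolic (on the left) and the Iwahori subgroup (on the right). -/
def siegelPosition (g : Matrix (Fin 4) (Fin 4) F) : Prop × Prop × Prop :=
  (g 2 1 = 0 ∧ g 3 1 = 0,
    g 2 0 * g 3 1 - g 2 1 * g 3 0 = 0,
    (g 2 1 = 0 ∧ g 3 1 = 0) ∧ g 2 0 = 0 ∧ g 3 0 = 0)

/-- The vanishing conditions on the third row of a matrix, relative to the flag fixed by the
Iwahori subgroup. -/
def rowPosition (g : Matrix (Fin 4) (Fin 4) F) : Prop × Prop × Prop :=
  (g 2 1 = 0, g 2 1 = 0 ∧ g 2 0 = 0, g 2 1 = 0 ∧ g 2 0 = 0 ∧ g 2 2 = 0)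

/-- The shape of the reduction modulo `p` of an element of the Iwahori subgroup. -/
def IsBorelShaped (k : Matrix (Fin 4) (Fin 4) F) : Prop :=
  k 0 1 = 0 ∧ k 2 0 = 0 ∧ k 2 1 = 0 ∧ k 3 0 = 0 ∧ k 3 1 = 0 ∧ k 3 2 = 0

lemma IsBorelShaped.det {k : Matrix (Fin 4) (Fin 4) F} (hk : IsBorelShaped k) :
    k.det = k 0 0 * k 1 1 * k 2 2 * k 3 3 := by
  obtain ⟨h1, h2, h3, h4, h5, h6⟩ := hk
  simp [Matrix.det_succ_row_zero, Fin.sum_univ_succ, Fin.succAbove,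
    show Fin.succ (2 : Fin 3) = (3 : Fin 4) from rfl, *]
  ring

lemma det_of_lowerLeft_eq_zero {M : Matrix (Fin 4) (Fin 4) F}
    (h20 : M 2 0 = 0) (h21 : M 2 1 = 0) (h30 : M 3 0 = 0) (h31 : M 3 1 = 0) :
    M.det = (M 0 0 * M 1 1 - M 0 1 * M 1 0) * (M 2 2 * M 3 3 - M 2 3 * M 3 2) := by
  simp [Matrix.det_succ_row_zero, Fin.sum_univ_succ, Fin.succAbove,
    show Fin.succ (2 : Fin 3) = (3 : Fin 4) from rfl, *]
  ring

lemma IsBorelShaped.diag_ne_zero {k : Matrix (Fin 4) (Fin 4) F} (hk : IsBorelShaped k)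
    (hdet : k.det ≠ 0) : k 0 0 ≠ 0 ∧ k 1 1 ≠ 0 ∧ k 2 2 ≠ 0 := by
  rw [hk.det] at hdet
  refine ⟨?_, ?_, ?_⟩ <;> · intro h; simp [h] at hdet

lemma siegelPosition_mul_right (f : Matrix (Fin 4) (Fin 4) F) {k : Matrix (Fin 4) (Fin 4) F}
    (hk : IsBorelShaped k) (hdet : k.det ≠ 0) :
    siegelPosition (f * k) = siegelPosition f := by
  obtain ⟨h0, h1, -⟩ := hk.diag_ne_zero hdet
  obtain ⟨z1, z2, z3, z4, z5, z6⟩ := hk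
  have e1 (i) : (f * k) i 1 = f i 1 * k 1 1 := by
    simp [Matrix.mul_apply, Fin.sum_univ_four, z1, z3, z5]
  have e0 (i) : (f * k) i 0 = f i 0 * k 0 0 + f i 1 * k 1 0 := by
    simp [Matrix.mul_apply, Fin.sum_univ_four, z2, z4]
  have minor : (f * k) 2 0 * (f * k) 3 1 - (f * k) 2 1 * (f * k) 3 0 =
      (f 2 0 * f 3 1 - f 2 1 * f 3 0) * (k 0 0 * k 1 1) := by
    rw [e1, e1, e0, e0]; ring
  unfold siegelPosition
  rw [minor, e1, e1, e0, e0]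
  simp +contextual only [Prod.mk.injEq, eq_iff_iff, mul_eq_zero, h0, h1, or_false, zero_mul,
    add_zero, and_congr_right_iff, implies_true, and_self]

lemma rowPosition_mul_right (f : Matrix (Fin 4) (Fin 4) F) {k : Matrix (Fin 4) (Fin 4) F}
    (hk : IsBorelShaped k) (hdet : k.det ≠ 0) :
    rowPosition (f * k) = rowPosition f := by
  obtain ⟨h0, h1, h2⟩ := hk.diag_ne_zero hdet
  obtain ⟨z1, z2, z3, z4, z5, z6⟩ := hk
  have e1 : (f * k) 2 1 = f 2 1 * k 1 1 := by
    simp [Matrix.mul_apply, Fin.sum_univ_four, z1, z3, z5]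
  have e0 : (f * k) 2 0 = f 2 0 * k 0 0 + f 2 1 * k 1 0 := by
    simp [Matrix.mul_apply, Fin.sum_univ_four, z2, z4]
  have e2 : (f * k) 2 2 = f 2 0 * k 0 2 + f 2 1 * k 1 2 + f 2 2 * k 2 2 := by
    simp [Matrix.mul_apply, Fin.sum_univ_four, z6]
  unfold rowPosition
  rw [e1, e0, e2]
  simp +contextual [h0, h1, h2]

lemma siegelPosition_mul_left {M : Matrix (Fin 4) (Fin 4) F} (f : Matrix (Fin 4) (Fin 4) F)
    (h20 : M 2 0 = 0) (h21 : M 2 1 = 0) (h30 : M 3 0 = 0) (h31 : M 3 1 = 0)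
    (hdet : M.det ≠ 0) : siegelPosition (M * f) = siegelPosition f := by
  rw [det_of_lowerLeft_eq_zero h20 h21 h30 h31] at hdet
  have hD := right_ne_zero_of_mul hdet
  have e2 (j) : (M * f) 2 j = M 2 2 * f 2 j + M 2 3 * f 3 j := by
    simp [Matrix.mul_apply, Fin.sum_univ_four, h20, h21]
  have e3 (j) : (M * f) 3 j = M 3 2 * f 2 j + M 3 3 * f 3 j := by
    simp [Matrix.mul_apply, Fin.sum_univ_four, h30, h31]
  have col (j) : ((M * f) 2 j = 0 ∧ (M * f) 3 j = 0) ↔ (f 2 j = 0 ∧ f 3 j = 0) := by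
    rw [e2, e3]
    constructor
    · rintro ⟨u, v⟩
      constructor <;> apply (mul_eq_zero.1 _).resolve_left hD
      · linear_combination M 3 3 * u - M 2 3 * v
      · linear_combination M 2 2 * v - M 3 2 * u
    · rintro ⟨u, v⟩
      simp [u, v]
  have minor : (M * f) 2 0 * (M * f) 3 1 - (M * f) 2 1 * (M * f) 3 0 =
      (M 2 2 * M 3 3 - M 2 3 * M 3 2) * (f 2 0 * f 3 1 - f 2 1 * f 3 0) := by
    rw [e2, e2, e3, e3]; ring
  unfold siegelPosition
  rw [col, col, minor]
  simp only [mul_eq_zero, hD, false_or]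

lemma rowPosition_mul_left {M : Matrix (Fin 4) (Fin 4) F} (f : Matrix (Fin 4) (Fin 4) F)
    (h20 : M 2 0 = 0) (h21 : M 2 1 = 0) (h30 : M 3 0 = 0) (h31 : M 3 1 = 0)
    (h23 : M 2 3 = 0) (hdet : M.det ≠ 0) : rowPosition (M * f) = rowPosition f := by
  rw [det_of_lowerLeft_eq_zero h20 h21 h30 h31, h23, zero_mul, sub_zero] at hdet
  have h22 := left_ne_zero_of_mul (right_ne_zero_of_mul hdet)
  have e2 (j) : (M * f) 2 j = M 2 2 * f 2 j := by
    simp [Matrix.mul_apply, Fin.sum_univ_four, h20, h21, h23]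
  simp only [rowPosition, e2, mul_eq_zero, h22, false_or]

end BruhatPosition

section Reduction

variable {p}

lemma toZMod_eq_zero_of_norm_lt_one {x : ℤ_[p]} (hx : ‖x‖ < 1) : PadicInt.toZMod x = 0 := by
  rw [← RingHom.mem_ker, PadicInt.ker_toZMod]
  exact PadicInt.mem_nonunits.2 hx

lemma exists_padicInt_lift {k : Matrix (Fin 4) (Fin 4) ℚ_[p]} (hk : ∀ i j, ‖k i j‖ ≤ 1) :
    ∃ K : Matrix (Fin 4) (Fin 4) ℤ_[p], K.map PadicInt.Coe.ringHom = k :=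
  ⟨fun i j => ⟨k i j, hk i j⟩, rfl⟩

lemma Ip.exists_lift {k : Matrix (Fin 4) (Fin 4) ℚ_[p]} (hk : k ∈ Ip p) :
    ∃ K : Matrix (Fin 4) (Fin 4) ℤ_[p], K.map PadicInt.Coe.ringHom = k ∧ IsUnit K.det ∧
      IsBorelShaped (K.map PadicInt.toZMod) := by
  obtain ⟨⟨-, hint, hdet⟩, h1, h2, h3, h4, h5, h6⟩ := hk
  obtain ⟨K, rfl⟩ := exists_padicInt_lift hint
  refine ⟨K, rfl, ?_, ?_⟩
  · rw [← RingHom.mapMatrix_apply, ← RingHom.map_det] at hdet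
    exact PadicInt.isUnit_iff.2 hdet
  · exact ⟨toZMod_eq_zero_of_norm_lt_one h1, toZMod_eq_zero_of_norm_lt_one h2,
      toZMod_eq_zero_of_norm_lt_one h3, toZMod_eq_zero_of_norm_lt_one h4,
      toZMod_eq_zero_of_norm_lt_one h5, toZMod_eq_zero_of_norm_lt_one h6⟩

variable {a b c}

lemma Tgrp.offDiag_relation {t : Matrix (Fin 2) (Fin 2) ℚ_[p]} (ht : t ∈ Tgrp p a b c) :
    c * t 1 0 = -(a * t 0 1) := by
  obtain ⟨hu, h⟩ := ht
  have h' : tᵀ * Smat p a b c * (t * t.adjugate) = t.det • Smat p a b c * t.adjugate := by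
    rw [← Matrix.mul_assoc, h]
  rw [Matrix.mul_adjugate, Matrix.mul_smul, Matrix.mul_one, Matrix.smul_mul] at h'
  have h01 := congrFun (congrFun (smul_right_injective _ hu.ne_zero h') 0) 1
  simp [Smat, Matrix.mul_apply, Matrix.adjugate_fin_two] at h01
  linear_combination h01

lemma Rgrp.lower_rows {r : Matrix (Fin 4) (Fin 4) ℚ_[p]} (hr : r ∈ Rgrp p a b c) :
    r 2 0 = 0 ∧ r 2 1 = 0 ∧ r 3 0 = 0 ∧ r 3 1 = 0 ∧ c * r 2 3 = -(a * r 3 2) := by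
  obtain ⟨t, ht, _, ⟨X, -, rfl⟩, rfl⟩ := hr
  have hD : t.det • (t⁻¹)ᵀ = t.adjugateᵀ := by
    rw [Matrix.inv_def, Matrix.transpose_smul, smul_smul, Ring.mul_inverse_cancel _ ht.1,
      one_smul]
  have hr : emb p t * blk p 1 X 0 1 = blk p t (t * X) 0 t.adjugateᵀ := by
    simp [emb, blk, hD, Matrix.submatrix_mul_equiv, Matrix.fromBlocks_multiply]
  rw [hr]
  refine ⟨rfl, rfl, rfl, rfl, ?_⟩
  change c * t.adjugateᵀ 0 1 = -(a * t.adjugateᵀ 1 0)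
  simp [Matrix.adjugate_fin_two]
  linear_combination -Tgrp.offDiag_relation ht

/-- If two integral unimodular matrices are `(l,m)`-equivalent, then their reductions modulo `p`
are in the same Siegel position, and their third rows are in the same position if `m ≠ 0`. -/
lemma LMEquiv.position_eq (ha : ‖a‖ = 1) (hc : ‖c‖ = 1) {l : ℤ} {m : ℕ}
    {f g : Matrix (Fin 4) (Fin 4) ℤ} (hf : IsUnit f.det) (hg : IsUnit g.det)
    (h : LMEquiv p a b c l m (f.map (Int.castRingHom _)) (g.map (Int.castRingHom _))) :
    siegelPosition (f.map (Int.castRingHom (ZMod p))) =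
        siegelPosition (g.map (Int.castRingHom (ZMod p))) ∧
      (m ≠ 0 → rowPosition (f.map (Int.castRingHom (ZMod p))) =
        rowPosition (g.map (Int.castRingHom (ZMod p)))) := by
  obtain ⟨r, hr, k, hk, hrk⟩ := h
  obtain ⟨K, rfl, hKdet, hKshape⟩ := Ip.exists_lift hk
  obtain ⟨r20, r21, r30, r31, r23⟩ := Rgrp.lower_rows hr
  set φ : ℤ_[p] →+* ℚ_[p] := PadicInt.Coe.ringHom
  set f' := f.map (Int.castRingHom ℤ_[p])
  set g' := g.map (Int.castRingHom ℤ_[p])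
  have lift (s : Matrix (Fin 4) (Fin 4) ℤ) :
      s.map (Int.castRingHom ℚ_[p]) = (s.map (Int.castRingHom ℤ_[p])).map φ := by
    ext i j; simp
  have redn (s : Matrix (Fin 4) (Fin 4) ℤ) :
      s.map (Int.castRingHom (ZMod p)) = (s.map (Int.castRingHom ℤ_[p])).map PadicInt.toZMod := by
    ext i j; simp
  have det_unit {s : Matrix (Fin 4) (Fin 4) ℤ} (hs : IsUnit s.det) :
      IsUnit (s.map (Int.castRingHom ℤ_[p])).det := by
    rw [← RingHom.mapMatrix_apply, ← RingHom.map_det]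
    exact hs.map _
  have hfK : IsUnit (f' * K).det := by
    rw [Matrix.det_mul]
    exact (det_unit hf).mul hKdet
  set M := g' * (f' * K)⁻¹
  have hM : M * (f' * K) = g' := Matrix.nonsing_inv_mul_cancel_right _ _ hfK
  have hMdet : IsUnit M.det := by
    have := det_unit hg
    change IsUnit g'.det at this
    rw [← hM, Matrix.det_mul] at this
    exact isUnit_of_mul_isUnit_left this
  have key : r * hmat p l m = hmat p l m * M.map φ := by
    have hu : IsUnit ((f' * K).map φ) := by
      rw [Matrix.isUnit_iff_isUnit_det, ← RingHom.mapMatrix_apply, ← RingHom.map_det]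
      exact hfK.map _
    apply hu.mul_left_injective
    change r * hmat p l m * (f' * K).map φ = hmat p l m * M.map φ * (f' * K).map φ
    rw [Matrix.mul_assoc (hmat p l m), ← Matrix.map_mul, hM, Matrix.map_mul, ← Matrix.mul_assoc,
      ← lift, ← lift]
    exact hrk
  have entry (i j) := congrFun (congrFun key i) j
  have φ_apply (x : ℤ_[p]) : φ x = (x : ℚ_[p]) := rfl
  simp only [hmat, Matrix.mul_diagonal, Matrix.diagonal_mul, Matrix.map_apply, φ_apply] at entry
  have hp0 : (p : ℚ_[p]) ≠ 0 := by exact_mod_cast (Fact.out : p.Prime).ne_zero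
  have hpm : (p : ℚ_[p]) ^ (m : ℤ) ≠ 0 := zpow_ne_zero _ hp0
  have M20 : M 2 0 = 0 := by simpa [r20] using (entry 2 0).symm
  have M21 : M 2 1 = 0 := by simpa [r21] using (entry 2 1).symm
  have M30 : M 3 0 = 0 := by simpa [r30, hp0] using (entry 3 0).symm
  have M31 : M 3 1 = 0 := by simpa [r31, hp0] using (entry 3 1).symm
  have M23 (hm : m ≠ 0) : ‖M 2 3‖ < 1 := by
    have e23 : r 2 3 * p ^ m = (M 2 3 : ℚ_[p]) := by simpa using entry 2 3
    have e32 : r 3 2 = p ^ m * (M 3 2 : ℚ_[p]) := by simpa using entry 3 2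
    have e : c * (M 2 3 : ℚ_[p]) = -(a * (p ^ m * p ^ m * M 3 2)) := by
      rw [← e23]
      linear_combination (p : ℚ_[p]) ^ m * r23 - a * p ^ m * e32
    have n := congrArg norm e
    have hp1 : ‖(p : ℚ_[p])‖ ^ m < 1 := pow_lt_one₀ (norm_nonneg _) Padic.norm_p_lt_one hm
    have hp2 : 0 ≤ ‖(p : ℚ_[p])‖ ^ m := by positivity
    simp only [norm_mul, norm_neg, norm_pow, ha, hc, one_mul] at n
    rw [PadicInt.norm_def, n]
    have := PadicInt.norm_le_one (M 3 2)
    rw [PadicInt.norm_def] at this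
    nlinarith [norm_nonneg (M 3 2 : ℚ_[p])]
  have hred : g'.map PadicInt.toZMod =
      M.map PadicInt.toZMod * (f'.map PadicInt.toZMod * K.map PadicInt.toZMod) := by
    rw [← Matrix.map_mul, ← Matrix.map_mul, hM]
  have red_det {N : Matrix (Fin 4) (Fin 4) ℤ_[p]} (hN : IsUnit N.det) :
      (N.map (PadicInt.toZMod (p := p))).det ≠ 0 := by
    rw [← RingHom.mapMatrix_apply, ← RingHom.map_det]
    exact (hN.map _).ne_zero
  have vanish {i j} (h : M i j = 0) : M.map (PadicInt.toZMod (p := p)) i j = 0 := by simp [h]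
  rw [redn f, redn g, hred]
  refine ⟨?_, fun hm => ?_⟩
  · rw [siegelPosition_mul_left _ (vanish M20) (vanish M21) (vanish M30) (vanish M31)
      (red_det hMdet), siegelPosition_mul_right _ hKshape (red_det hKdet)]
  · rw [rowPosition_mul_left _ (vanish M20) (vanish M21) (vanish M30) (vanish M31)
      (toZMod_eq_zero_of_norm_lt_one (M23 hm)) (red_det hMdet),
      rowPosition_mul_right _ hKshape (red_det hKdet)]

end Reduction

/-- Integral models of the matrices `t₁, …, t₈`. -/
def tInt : Fin 8 → Matrix (Fin 4) (Fin 4) ℤ :=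
  ![!![-1,0,0,0; 0,-1,0,0; 1,0,-1,0; 0,0,0,-1],
    !![0,-1,0,0; -1,0,0,0; 0,1,0,-1; 0,0,-1,0],
    !![-1,0,0,0; 0,-1,0,0; 0,0,-1,0; 0,1,0,-1],
    !![0,-1,0,0; -1,0,0,0; 0,0,0,-1; 1,0,-1,0],
    !![-1,0,0,0; 0,-1,0,0; 0,0,-1,0; 0,0,0,-1],
    !![0,-1,0,0; -1,0,0,0; 0,0,0,-1; 0,0,-1,0],
    !![0,0,1,0; 0,0,0,1; -1,0,0,0; 0,-1,0,0],
    !![0,0,0,1; 0,0,1,0; 0,-1,0,0; -1,0,0,0]]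

lemma tInt_isUnit_det (i : Fin 8) : IsUnit (tInt i).det := by
  rw [Int.isUnit_iff]
  revert i
  decide +kernel

lemma tInt_cast_eq (i : Fin 8) : (tInt i).map (Int.castRingHom ℚ_[p]) =
    ![t1 p, t2 p, t3 p, t4 p, t5 p, t6 p, t7 p, t8 p] i := by
  fin_cases i <;>
    simp [tInt, t1, t2, t3, t4, t5, t6, t7, t8, Jmat, Umat, Zmat, Zinf] <;>
    ext j k <;> fin_cases j <;> fin_cases k <;> simp

lemma exists_tInt_of_mem_TsetM {m : ℕ} {s : Matrix (Fin 4) (Fin 4) ℚ_[p]}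
    (hs : s ∈ TsetM p m) : ∃ i : Fin 8, (m = 0 → i = 0 ∨ i = 1 ∨ i = 4 ∨ i = 6) ∧
      s = (tInt i).map (Int.castRingHom ℚ_[p]) := by
  simp only [tInt_cast_eq]
  unfold TsetM at hs
  split_ifs at hs with hm
  · rcases hs with rfl | rfl | rfl | rfl
    exacts [⟨0, by simp⟩, ⟨1, by simp⟩, ⟨4, by simp⟩, ⟨6, by simp⟩]
  · rcases hs with rfl | rfl | rfl | rfl | rfl | rfl | rfl | rfl
    exacts [⟨0, by simp [hm]⟩, ⟨1, by simp [hm]⟩, ⟨2, by simp [hm]⟩, ⟨3, by simp [hm]⟩,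
      ⟨4, by simp [hm]⟩, ⟨5, by simp [hm]⟩, ⟨6, by simp [hm]⟩, ⟨7, by simp [hm]⟩]

lemma tInt_siegelPosition_injOn {i j : Fin 8} (hi : i = 0 ∨ i = 1 ∨ i = 4 ∨ i = 6)
    (hj : j = 0 ∨ j = 1 ∨ j = 4 ∨ j = 6)
    (h : siegelPosition ((tInt i).map (Int.castRingHom (ZMod p))) =
      siegelPosition ((tInt j).map (Int.castRingHom (ZMod p)))) : i = j := by
  rcases hi with rfl | rfl | rfl | rfl <;> rcases hj with rfl | rfl | rfl | rfl <;>
    simp [siegelPosition, tInt] at h ⊢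

lemma tInt_position_injective {i j : Fin 8}
    (hs : siegelPosition ((tInt i).map (Int.castRingHom (ZMod p))) =
      siegelPosition ((tInt j).map (Int.castRingHom (ZMod p))))
    (hr : rowPosition ((tInt i).map (Int.castRingHom (ZMod p))) =
      rowPosition ((tInt j).map (Int.castRingHom (ZMod p)))) : i = j := by
  fin_cases i <;> fin_cases j <;> simp [siegelPosition, rowPosition, tInt] at hs hr ⊢

theorem Tm_pairwise_inequivalent (a b c : ℚ_[p])
    (ha : ‖a‖ = 1) (hb : ‖b‖ ≤ 1) (hc : ‖c‖ = 1)
    (hd : ‖b ^ 2 - 4 * a * c‖ = 1)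
    (hnsq : ∀ z : ℚ_[p], z ^ 2 ≠ b ^ 2 - 4 * a * c)
    (l : ℤ) (m : ℕ) :
    ∀ s₁ ∈ TsetM p m, ∀ s₂ ∈ TsetM p m, s₁ ≠ s₂ →
      ¬ LMEquiv p a b c l m s₁ s₂ := by
  intro s₁ h₁ s₂ h₂ hne h
  obtain ⟨i, hi, rfl⟩ := exists_tInt_of_mem_TsetM p h₁
  obtain ⟨j, hj, rfl⟩ := exists_tInt_of_mem_TsetM p h₂
  obtain ⟨hs, hr⟩ := h.position_eq ha hc (tInt_isUnit_det i) (tInt_isUnit_det j)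
  apply hne
  by_cases hm : m = 0
  · rw [tInt_siegelPosition_injOn p (hi hm) (hj hm) hs]
  · rw [tInt_position_injective p hs (hr hm)]
end
end
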